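/- Let R and B be disjoint finite sets of points in the plane with |R| = |B| = n, and let L be a line containing exactly r points of R and exactly b points of B. If r + b < n, then R ∪ B determines at least (b² + b + r² + r)/2 bichromatic lines. -/

import Mathlib

open scoped Classical

noncomputable section

/-- A line in the plane: the affine span of two distinct points. -/
def IsLine (L : Set (ℝ × ℝ)) : Prop :=
  ∃ p q : ℝ × ℝ, p ≠ q ∧ L = (affineSpan ℝ ({p, q} : Set (ℝ × ℝ)) : Set (ℝ × ℝ))

/-- The points of the finite set `P` lying on `L`. -/
def ptsOn (P : Finset (ℝ × ℝ)) (L : Set (ℝ × ℝ)) : Finset (ℝ × ℝ) :=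
  P.filter (fun x => x ∈ L)

/-- A line determined by `P`: contains at least two points of `P`. -/
def DeterminedLine (P : Finset (ℝ × ℝ)) (L : Set (ℝ × ℝ)) : Prop :=
  IsLine L ∧ 2 ≤ (ptsOn P L).card

/-- A bichromatic line: determined by `R ∪ B`, with at least one red and one blue point. -/
def BichromaticLine (R B : Finset (ℝ × ℝ)) (L : Set (ℝ × ℝ)) : Prop :=
  DeterminedLine (R ∪ B) L ∧ (∃ p ∈ R, p ∈ L) ∧ (∃ p ∈ B, p ∈ L)

/-- The number of bichromatic lines determined by `R ∪ B`. -/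
def nBichromatic (R B : Finset (ℝ × ℝ)) : ℕ :=
  {L : Set (ℝ × ℝ) | BichromaticLine R B L}.ncard

/-- A near-pencil: some line contains all but exactly one of the points of `P`. -/
def NearPencil (P : Finset (ℝ × ℝ)) : Prop :=
  ∃ L : Set (ℝ × ℝ), IsLine L ∧ (ptsOn P L).card = P.card - 1

/-- The line through `p` and `q`. -/
def lineThrough (p q : ℝ × ℝ) : Set (ℝ × ℝ) :=
  (affineSpan ℝ ({p, q} : Set (ℝ × ℝ)) : Set (ℝ × ℝ))

lemma left_mem_lineThrough (p q : ℝ × ℝ) : p ∈ lineThrough p q :=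
  left_mem_affineSpan_pair ℝ p q

lemma right_mem_lineThrough (p q : ℝ × ℝ) : q ∈ lineThrough p q :=
  right_mem_affineSpan_pair ℝ p q

lemma isLine_lineThrough {p q : ℝ × ℝ} (h : p ≠ q) : IsLine (lineThrough p q) :=
  ⟨p, q, h, rfl⟩

lemma IsLine.eq_lineThrough {L : Set (ℝ × ℝ)} (hL : IsLine L) {p q : ℝ × ℝ}
    (hp : p ∈ L) (hq : q ∈ L) (hpq : p ≠ q) : L = lineThrough p q := by
  obtain ⟨x, y, -, rfl⟩ := hL
  rw [SetLike.mem_coe, mem_affineSpan_pair_iff_exists_lineMap_eq] at hp hq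
  obtain ⟨s, rfl⟩ := hp
  obtain ⟨t, rfl⟩ := hq
  have hst : t - s ≠ 0 := by
    intro h
    rw [sub_eq_zero] at h
    exact hpq (by rw [h])
  refine Set.Subset.antisymm (fun z hz => ?_) ?_
  · rw [SetLike.mem_coe, mem_affineSpan_pair_iff_exists_lineMap_eq] at hz
    obtain ⟨u, rfl⟩ := hz
    refine (mem_affineSpan_pair_iff_exists_lineMap_eq ..).2 ⟨(u - s) / (t - s), ?_⟩
    ext <;> simp [AffineMap.lineMap_apply] <;> field_simp <;> ring
  · refine affineSpan_le.2 ?_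
    rintro z (rfl | rfl) <;> exact AffineMap.lineMap_mem_affineSpan_pair _ _ _

lemma IsLine.eq_of_mem {L M : Set (ℝ × ℝ)} (hL : IsLine L) (hM : IsLine M) {p q : ℝ × ℝ}
    (hpL : p ∈ L) (hqL : q ∈ L) (hpM : p ∈ M) (hqM : q ∈ M) (hpq : p ≠ q) : L = M :=
  (hL.eq_lineThrough hpL hqL hpq).trans (hM.eq_lineThrough hpM hqM hpq).symm

/-- The lines joining a point of `A` to a point of `Q`. -/
def joiningLines (A Q : Finset (ℝ × ℝ)) : Finset (Set (ℝ × ℝ)) :=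
  Finset.image₂ lineThrough A Q

lemma mem_joiningLines {A Q : Finset (ℝ × ℝ)} {M : Set (ℝ × ℝ)} :
    M ∈ joiningLines A Q ↔ ∃ a ∈ A, ∃ q ∈ Q, lineThrough a q = M :=
  Finset.mem_image₂

lemma card_joiningLines_singleton {L : Set (ℝ × ℝ)} (hL : IsLine L) {A : Finset (ℝ × ℝ)}
    (hA : ∀ a ∈ A, a ∈ L) {q : ℝ × ℝ} (hq : q ∉ L) : (joiningLines A {q}).card = A.card := by
  rw [joiningLines, Finset.image₂_singleton_right]
  refine Finset.card_image_of_injOn fun a ha a' ha' h => ?_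
  by_contra hne
  have hM := isLine_lineThrough (ne_of_mem_of_not_mem (hA a ha) hq)
  have h' : a' ∈ lineThrough a q := (congrArg (a' ∈ ·) h).mpr (left_mem_lineThrough a' q)
  have hLM := hL.eq_of_mem hM (hA a ha) (hA a' ha') (left_mem_lineThrough a q) h' hne
  exact hq (hLM ▸ right_mem_lineThrough a q)

lemma card_joiningLines_singleton_inter_le {A Q : Finset (ℝ × ℝ)} {q : ℝ × ℝ} (hqA : q ∉ A)
    (hqQ : q ∉ Q) : (joiningLines A {q} ∩ joiningLines A Q).card ≤ Q.card := by
  refine (Finset.card_le_card (t := Q.image (lineThrough q)) fun M hM => ?_).trans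
    Finset.card_image_le
  simp only [Finset.mem_inter, mem_joiningLines, Finset.mem_singleton, exists_eq_left] at hM
  obtain ⟨⟨a, ha, rfl⟩, a', -, q', hq', h⟩ := hM
  refine Finset.mem_image.2 ⟨q', hq', Eq.symm ?_⟩
  exact (isLine_lineThrough (ne_of_mem_of_not_mem ha hqA)).eq_lineThrough
    (right_mem_lineThrough a q) (h ▸ right_mem_lineThrough a' q')
    (ne_of_mem_of_not_mem hq' hqQ).symm

lemma joiningLines_insert (A Q : Finset (ℝ × ℝ)) (q : ℝ × ℝ) :
    joiningLines A (insert q Q) = joiningLines A {q} ∪ joiningLines A Q := by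
  rw [Finset.insert_eq, joiningLines, Finset.image₂_union_right]
  rfl

lemma card_mul_le_card_joiningLines {L : Set (ℝ × ℝ)} (hL : IsLine L) {A : Finset (ℝ × ℝ)}
    (hA : ∀ a ∈ A, a ∈ L) (Q : Finset (ℝ × ℝ)) (hQ : ∀ q ∈ Q, q ∉ L) :
    2 * Q.card * A.card + Q.card ≤ 2 * (joiningLines A Q).card + Q.card ^ 2 := by
  induction Q using Finset.induction_on with
  | empty => simp
  | insert q Q hq ih =>
    rw [Finset.forall_mem_insert] at hQ
    have hqA : q ∉ A := fun h => hQ.1 (hA q h)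
    have h_single := card_joiningLines_singleton hL hA hQ.1
    have h_inter := card_joiningLines_singleton_inter_le hqA hq
    have h_union := Finset.card_union_add_card_inter (joiningLines A {q}) (joiningLines A Q)
    rw [joiningLines_insert, Finset.card_insert_of_notMem hq]
    have := ih hQ.2
    nlinarith

/-- If `Q` has at least as many points as `A`, then `A` and `Q` are joined by at least
`|A| (|A| + 1) / 2` lines. -/
lemma card_sq_add_card_le_two_mul_card_joiningLines {L : Set (ℝ × ℝ)} (hL : IsLine L)
    {A Q : Finset (ℝ × ℝ)} (hA : ∀ a ∈ A, a ∈ L) (hQ : ∀ q ∈ Q, q ∉ L) (h : A.card ≤ Q.card) :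
    A.card ^ 2 + A.card ≤ 2 * (joiningLines A Q).card := by
  obtain ⟨Q', hQ', hcard⟩ := Finset.exists_subset_card_eq h
  have hle := card_mul_le_card_joiningLines hL hA Q' fun q hq => hQ q (hQ' hq)
  have hmono : (joiningLines A Q').card ≤ (joiningLines A Q).card :=
    Finset.card_le_card (Finset.image₂_subset_left hQ')
  rw [hcard] at hle
  nlinarith

lemma disjoint_joiningLines {L : Set (ℝ × ℝ)} (hL : IsLine L) {A A' Q Q' : Finset (ℝ × ℝ)}
    (hA : ∀ a ∈ A, a ∈ L) (hA' : ∀ a ∈ A', a ∈ L) (hQ : ∀ q ∈ Q, q ∉ L) (hAA' : Disjoint A A') :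
    Disjoint (joiningLines A Q) (joiningLines A' Q') := by
  refine Finset.disjoint_left.2 fun M hM hM' => ?_
  obtain ⟨a, ha, q, hq, rfl⟩ := mem_joiningLines.1 hM
  obtain ⟨a', ha', q', -, h⟩ := mem_joiningLines.1 hM'
  have hLM := hL.eq_of_mem (isLine_lineThrough (ne_of_mem_of_not_mem (hA a ha) (hQ q hq)))
    (hA a ha) (hA' a' ha') (left_mem_lineThrough a q) (h ▸ left_mem_lineThrough a' q')
    fun h_eq => Finset.disjoint_left.1 hAA' ha (h_eq ▸ ha')
  exact hQ q hq (hLM ▸ right_mem_lineThrough a q)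

lemma bichromaticLine_iff {R B : Finset (ℝ × ℝ)} (hRB : Disjoint R B) {M : Set (ℝ × ℝ)} :
    BichromaticLine R B M ↔ IsLine M ∧ (∃ p ∈ R, p ∈ M) ∧ ∃ p ∈ B, p ∈ M := by
  refine ⟨fun h => ⟨h.1.1, h.2⟩, fun ⟨hM, ⟨p, hp, hpM⟩, q, hq, hqM⟩ =>
    ⟨⟨hM, ?_⟩, ⟨p, hp, hpM⟩, q, hq, hqM⟩⟩
  refine Finset.one_lt_card.2 ⟨p, ?_, q, ?_, fun h => Finset.disjoint_left.1 hRB hp (h ▸ hq)⟩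
  · exact Finset.mem_filter.2 ⟨Finset.mem_union_left _ hp, hpM⟩
  · exact Finset.mem_filter.2 ⟨Finset.mem_union_right _ hq, hqM⟩

lemma lineThrough_comm (p q : ℝ × ℝ) : lineThrough p q = lineThrough q p := by
  rw [lineThrough, lineThrough, Set.pair_comm]

lemma joiningLines_comm (A Q : Finset (ℝ × ℝ)) : joiningLines A Q = joiningLines Q A :=
  Finset.image₂_comm lineThrough_comm

lemma setOf_bichromaticLine {R B : Finset (ℝ × ℝ)} (hRB : Disjoint R B) :
    {M | BichromaticLine R B M} = joiningLines R B := by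
  ext M
  rw [Set.mem_ofPred_eq, bichromaticLine_iff hRB, Finset.mem_coe, mem_joiningLines]
  constructor
  · rintro ⟨hM, ⟨p, hp, hpM⟩, q, hq, hqM⟩
    exact ⟨p, hp, q, hq, (hM.eq_lineThrough hpM hqM
      fun h => Finset.disjoint_left.1 hRB hp (h ▸ hq)).symm⟩
  · rintro ⟨p, hp, q, hq, rfl⟩
    exact ⟨isLine_lineThrough fun h => Finset.disjoint_left.1 hRB hp (h ▸ hq),
      ⟨p, hp, left_mem_lineThrough p q⟩, q, hq, right_mem_lineThrough p q⟩

/-- **Lemma 2.1, second part.** If `|R| = |B| = n` and a line `L` contains `r` red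
and `b` blue points with `r + b < n`, then there are at least `(b² + b + r² + r)/2`
bichromatic lines. -/
theorem bichromatic_count_from_small_line
    (R B : Finset (ℝ × ℝ)) (hRB : Disjoint R B) (n : ℕ)
    (hR : R.card = n) (hB : B.card = n)
    (L : Set (ℝ × ℝ)) (hL : IsLine L) (r b : ℕ)
    (hr : (ptsOn R L).card = r) (hb : (ptsOn B L).card = b)
    (hrb : r + b < n) :
    (b ^ 2 + b + r ^ 2 + r) / 2 ≤ nBichromatic R B := by
  have hR_split := Finset.card_filter_add_card_filter_not (s := R) (· ∈ L)
  have hB_split := Finset.card_filter_add_card_filter_not (s := B) (· ∈ L)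
  have hR_on : ∀ p ∈ ptsOn R L, p ∈ L := fun p hp => (Finset.mem_filter.1 hp).2
  have hB_on : ∀ p ∈ ptsOn B L, p ∈ L := fun p hp => (Finset.mem_filter.1 hp).2
  have hR_off : ∀ p ∈ R.filter (· ∉ L), p ∉ L := fun p hp => (Finset.mem_filter.1 hp).2
  have hB_off : ∀ p ∈ B.filter (· ∉ L), p ∉ L := fun p hp => (Finset.mem_filter.1 hp).2
  have h_red := card_sq_add_card_le_two_mul_card_joiningLines hL hR_on hB_off
    (by unfold ptsOn at *; omega)
  have h_blue := card_sq_add_card_le_two_mul_card_joiningLines hL hB_on hR_off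
    (by unfold ptsOn at *; omega)
  have h_disj : Disjoint (joiningLines (ptsOn R L) (B.filter (· ∉ L)))
      (joiningLines (ptsOn B L) (R.filter (· ∉ L))) :=
    disjoint_joiningLines hL hR_on hB_on hB_off
      (hRB.mono (Finset.filter_subset _ _) (Finset.filter_subset _ _))
  have h_sub : joiningLines (ptsOn R L) (B.filter (· ∉ L)) ∪
      joiningLines (ptsOn B L) (R.filter (· ∉ L)) ⊆ joiningLines R B := by
    refine Finset.union_subset
      (Finset.image₂_subset (Finset.filter_subset _ _) (Finset.filter_subset _ _)) ?_
    rw [joiningLines_comm]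
    exact Finset.image₂_subset (Finset.filter_subset _ _) (Finset.filter_subset _ _)
  have h_card := Finset.card_le_card h_sub
  rw [Finset.card_union_of_disjoint h_disj] at h_card
  rw [nBichromatic, setOf_bichromaticLine hRB, Set.ncard_coe_finset]
  rw [hr] at h_red
  rw [hb] at h_blue
  omega
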